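/- arXiv:1511.08970 — 2 statements merged into one kernel-verified Lean document; each statement's English description precedes it below -/
import Mathlib

section
/- Assume ‖A‖₂ < 1. Then the surrogate values along the IRLS iteration are nonincreasing: for every n ≥ 1, G(x^{n+1}, x^{n+1}, w^{n+1}, ε_{n+1}) ≤ G(x^n, x^n, w^n, ε_n). -/
open Finset Filter Matrix Topology

/-- Squared Euclidean residual plus generalized sparsity penalty:
`F(x) = ‖Ax - b‖₂² + 2 ∑ₖ λₖ |xₖ|^{qₖ}`. -/
noncomputable def Ffun {M N : ℕ} (A : Matrix (Fin M) (Fin N) ℝ) (b : Fin M → ℝ)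
    (lam q : Fin N → ℝ) (x : Fin N → ℝ) : ℝ :=
  (∑ i, (A.mulVec x i - b i) ^ 2) + 2 * ∑ k, lam k * |x k| ^ (q k)

/-- The surrogate functional `G(x,a,w,ε)`. -/
noncomputable def Gfun {M N : ℕ} (A : Matrix (Fin M) (Fin N) ℝ) (b : Fin M → ℝ)
    (lam q : Fin N → ℝ) (x a w : Fin N → ℝ) (ε : ℝ) : ℝ :=
  (∑ i, (A.mulVec x i - b i) ^ 2) - (∑ i, (A.mulVec (x - a) i) ^ 2)
    + (∑ k, (x k - a k) ^ 2)
    + ∑ k ∈ Finset.univ.filter (fun k => 1 ≤ q k ∧ q k < 2),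
        lam k * (q k * w k * ((x k) ^ 2 + ε ^ 2)
          + (2 - q k) * (w k) ^ (q k / (q k - 2)))
    + ∑ k ∈ Finset.univ.filter (fun k => q k = 2),
        2 * lam k * ((x k) ^ 2 + ε ^ 2) * ((w k) ^ 2 - 2 * w k + 2)

/-- Euclidean (ℓ²) norm on `Fin N → ℝ`. -/
noncomputable def l2 {N : ℕ} (v : Fin N → ℝ) : ℝ :=
  Real.sqrt (∑ k, (v k) ^ 2)

/-- Spectral (ℓ² operator) norm of a matrix. -/
noncomputable def specNorm {M N : ℕ} (A : Matrix (Fin M) (Fin N) ℝ) : ℝ :=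
  ‖LinearMap.toContinuousLinearMap (Matrix.toEuclideanLin A)‖

/-- A matrix of spectral norm at most one does not increase the Euclidean norm. -/
theorem sum_sq_mulVec_le {M N : ℕ} {A : Matrix (Fin M) (Fin N) ℝ} (hA : specNorm A ≤ 1)
    (v : Fin N → ℝ) : ∑ i, (A.mulVec v i) ^ 2 ≤ ∑ k, (v k) ^ 2 := by
  have h := (LinearMap.toContinuousLinearMap (Matrix.toEuclideanLin A)).le_of_opNorm_le hA
    (WithLp.toLp 2 v)
  rw [one_mul] at h
  have h2 := pow_le_pow_left₀ (norm_nonneg _) h 2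
  rw [EuclideanSpace.real_norm_sq_eq, EuclideanSpace.real_norm_sq_eq] at h2
  simpa using h2

/-- The tangent line inequality for the concave function `t ↦ t ^ p`, `0 ≤ p ≤ 1`. -/
theorem Real.rpow_le_rpow_add_mul_sub {s t p : ℝ} (hs : 0 < s) (ht : 0 ≤ t)
    (hp0 : 0 ≤ p) (hp1 : p ≤ 1) : t ^ p ≤ s ^ p + p * s ^ (p - 1) * (t - s) := by
  have h := rpow_one_add_le_one_add_mul_self (s := t / s - 1) (p := p)
    (by have := div_nonneg ht hs.le; linarith) hp0 hp1
  rw [add_sub_cancel, Real.div_rpow ht hs.le, div_le_iff₀ (Real.rpow_pos_of_pos hs p)] at h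
  refine h.trans_eq ?_
  rw [Real.rpow_sub_one hs.ne']
  field_simp

/-- At the weights `w = (x² + ε²) ^ ((q - 2) / 2)`, the diagonal surrogate is the residual plus
the smoothed penalty. -/
theorem Gfun_self {M N : ℕ} (A : Matrix (Fin M) (Fin N) ℝ) (b : Fin M → ℝ)
    (lam q x w : Fin N → ℝ) {ε : ℝ} (hq : ∀ k, 1 ≤ q k ∧ q k ≤ 2) (hε : 0 < ε)
    (hw : ∀ k, w k = ((x k) ^ 2 + ε ^ 2) ^ ((q k - 2) / 2)) :
    Gfun A b lam q x x w ε = (∑ i, (A.mulVec x i - b i) ^ 2)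
      + ∑ k, 2 * lam k * ((x k) ^ 2 + ε ^ 2) ^ (q k / 2) := by
  unfold Gfun
  simp only [sub_self, Matrix.mulVec_zero, Pi.zero_apply, ne_eq, OfNat.ofNat_ne_zero,
    not_false_eq_true, zero_pow, Finset.sum_const_zero, sub_zero, add_zero]
  rw [add_assoc, Finset.sum_filter, Finset.sum_filter, ← Finset.sum_add_distrib]
  congr 1
  refine Finset.sum_congr rfl fun k _ => ?_
  have hS : 0 < (x k) ^ 2 + ε ^ 2 := by positivity
  rcases (hq k).2.lt_or_eq with h | h
  · rw [if_pos ⟨(hq k).1, h⟩, if_neg h.ne, hw k, ← Real.rpow_mul hS.le]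
    have hne : q k - 2 ≠ 0 := by linarith
    have e1 : (q k - 2) / 2 * (q k / (q k - 2)) = q k / 2 := by field_simp
    have e2 : (q k - 2) / 2 = q k / 2 - 1 := by ring
    rw [e1, e2, Real.rpow_sub_one hS.ne']
    field_simp
    ring
  · rw [if_neg (by simp [h]), if_pos h, hw k, h]
    norm_num

/-- if `‖A‖₂ < 1`, the surrogate values along the IRLS iteration
are nonincreasing: for every `n ≥ 1`,
`G(x^{n+1},x^{n+1},w^{n+1},ε_{n+1}) ≤ G(xⁿ,xⁿ,wⁿ,εₙ)`. -/
theorem stmt_8 {M N : ℕ} (A : Matrix (Fin M) (Fin N) ℝ) (hA : specNorm A < 1)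
    (b : Fin M → ℝ) (lam q : Fin N → ℝ)
    (hlam : ∀ k, 0 < lam k) (hq : ∀ k, 1 ≤ q k ∧ q k ≤ 2)
    (x : ℕ → Fin N → ℝ) (eps : ℕ → ℝ) (w : ℕ → Fin N → ℝ)
    (α : ℝ) (hα0 : 0 < α) (hα1 : α < 1) (heps0 : 0 < eps 0)
    (hw : ∀ n k, w n k = ((x n k) ^ 2 + (eps n) ^ 2) ^ ((q k - 2) / 2))
    (hxiter : ∀ n k, x (n + 1) k =
      (1 + lam k * q k * w n k)⁻¹
        * (x n k + Aᵀ.mulVec b k - Aᵀ.mulVec (A.mulVec (x n)) k))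
    (hepsiter : ∀ n, eps (n + 1) =
      min (eps n) (Real.sqrt (l2 (x (n + 1) - x n) + α ^ (n + 1)))) :
    ∀ n : ℕ, 1 ≤ n →
      Gfun A b lam q (x (n + 1)) (x (n + 1)) (w (n + 1)) (eps (n + 1))
        ≤ Gfun A b lam q (x n) (x n) (w n) (eps n) := by
  have heps : ∀ n, 0 < eps n := by
    intro n
    induction n with
    | zero => exact heps0
    | succ n ih =>
      rw [hepsiter n]
      exact lt_min ih (Real.sqrt_pos.2 (add_pos_of_nonneg_of_pos (Real.sqrt_nonneg _)
        (pow_pos hα0 _)))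
  intro n _
  rw [Gfun_self A b lam q _ _ hq (heps _) (hw _), Gfun_self A b lam q _ _ hq (heps _) (hw _)]
  set d := x (n + 1) - x n with hd
  have hx' : x (n + 1) = x n + d := by simp [hd]
  have hresidual : ∑ i, (A.mulVec (x (n + 1)) i - b i) ^ 2
      = (∑ i, (A.mulVec (x n) i - b i) ^ 2)
        + 2 * (∑ k, Aᵀ.mulVec (A.mulVec (x n) - b) k * d k) + ∑ i, (A.mulVec d i) ^ 2 := by
    have hadj : ∑ k, Aᵀ.mulVec (A.mulVec (x n) - b) k * d k
        = ∑ i, (A.mulVec (x n) - b) i * A.mulVec d i := by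
      change Aᵀ *ᵥ (A *ᵥ x n - b) ⬝ᵥ d = (A *ᵥ x n - b) ⬝ᵥ A *ᵥ d
      rw [Matrix.mulVec_transpose, Matrix.dotProduct_mulVec]
    rw [hadj, Finset.mul_sum, ← Finset.sum_add_distrib, ← Finset.sum_add_distrib]
    refine Finset.sum_congr rfl fun i _ => ?_
    rw [hx', Matrix.mulVec_add]
    simp only [Pi.add_apply, Pi.sub_apply]
    ring
  have hcoord : ∀ k, 2 * (Aᵀ.mulVec (A.mulVec (x n) - b) k * d k) + (d k) ^ 2
      + 2 * lam k * ((x (n + 1) k) ^ 2 + (eps (n + 1)) ^ 2) ^ (q k / 2)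
      ≤ 2 * lam k * ((x n k) ^ 2 + (eps n) ^ 2) ^ (q k / 2) := by
    intro k
    have hS : 0 < (x n k) ^ 2 + (eps n) ^ 2 := by have := heps n; positivity
    have hW : 0 < w n k := by rw [hw]; exact Real.rpow_pos_of_pos hS _
    have hq0 : 0 < q k := by linarith [(hq k).1]
    have hc : 0 < lam k * q k * w n k := mul_pos (mul_pos (hlam k) hq0) hW
    have hε : (eps (n + 1)) ^ 2 ≤ (eps n) ^ 2 :=
      pow_le_pow_left₀ (heps _).le (by rw [hepsiter n]; exact min_le_left _ _) 2
    have htangent := Real.rpow_le_rpow_add_mul_sub (p := q k / 2) hS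
      (add_nonneg (sq_nonneg (x (n + 1) k)) (sq_nonneg (eps (n + 1))))
      (by linarith) (by linarith [(hq k).2])
    have hexp : q k / 2 - 1 = (q k - 2) / 2 := by ring
    rw [hexp, ← hw n k] at htangent
    have hpen := mul_le_mul_of_nonneg_left htangent (mul_pos two_pos (hlam k)).le
    have hstep : (1 + lam k * q k * w n k) * x (n + 1) k
        = x n k - Aᵀ.mulVec (A.mulVec (x n) - b) k := by
      rw [hxiter n k, mul_inv_cancel_left₀ (by positivity), Matrix.mulVec_sub, Pi.sub_apply]
      ring
    have hdk : d k = x (n + 1) k - x n k := rfl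
    have hg : Aᵀ.mulVec (A.mulVec (x n) - b) k
        = x n k - (1 + lam k * q k * w n k) * x (n + 1) k := by linarith
    rw [hg, hdk]
    nlinarith [mul_le_mul_of_nonneg_left hε hc.le, sq_nonneg (x (n + 1) k - x n k),
      mul_nonneg hc.le (sq_nonneg (x (n + 1) k - x n k))]
  have hsum := Finset.sum_le_sum fun k (_ : k ∈ Finset.univ) => hcoord k
  rw [Finset.sum_add_distrib, Finset.sum_add_distrib, ← Finset.mul_sum] at hsum
  linarith [sum_sq_mulVec_le hA.le d]
end

section
/- Suppose ‖x^{n+1} − x^n‖₂ → 0, ε_n → 0, and a subsequence {x^{n_r}} of the IRLS iterates converges to x̄ ∈ ℝ^N. Then for every index k with x̄_k ≠ 0, the limit x̄ satisfies the optimality condition (Aᵀ(b − A x̄))_k = λ_k q_k sgn(x̄_k) |x̄_k|^{q_k − 1}. -/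
open Finset Filter Matrix Topology

theorem abs_apply_le_l2 {N : ℕ} (v : Fin N → ℝ) (k : Fin N) : |v k| ≤ l2 v :=
  Real.abs_le_sqrt
    (Finset.single_le_sum (f := fun i => v i ^ 2) (fun i _ => sq_nonneg (v i)) (Finset.mem_univ k))

theorem tendsto_apply_zero_of_tendsto_l2_zero {ι : Type*} {l : Filter ι} {N : ℕ}
    {v : ι → Fin N → ℝ} (hv : Tendsto (fun n => l2 (v n)) l (𝓝 0)) (k : Fin N) :
    Tendsto (fun n => v n k) l (𝓝 0) :=
  squeeze_zero_norm (fun n => abs_apply_le_l2 (v n) k) hv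

theorem sq_rpow_half_sub_two_mul_self {a : ℝ} (ha : a ≠ 0) (p : ℝ) :
    (a ^ 2) ^ ((p - 2) / 2) * a = Real.sign a * |a| ^ (p - 1) := by
  have hpos : 0 < |a| := abs_pos.mpr ha
  have hpow : (a ^ 2) ^ ((p - 2) / 2) = |a| ^ (p - 2) := by
    rw [← sq_abs, ← Real.rpow_natCast, ← Real.rpow_mul hpos.le]
    congr 1
    push_cast
    ring
  have hsucc : |a| ^ (p - 1) = |a| ^ (p - 2) * |a| := by
    rw [← Real.rpow_add_one hpos.ne']
    congr 1
    ring
  have hsign : Real.sign a * |a| = a := by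
    rcases lt_or_gt_of_ne ha with h | h
    · rw [Real.sign_of_neg h, abs_of_neg h]
      ring
    · rw [Real.sign_of_pos h, abs_of_pos h, one_mul]
  rw [hpow, hsucc, mul_left_comm, hsign]

/-- if `‖x^{n+1} - xⁿ‖₂ → 0`, `εₙ → 0` and a subsequence
`x^{n_r} → x̄`, then for every `k` with `x̄ₖ ≠ 0`,
`(Aᵀ(b - A x̄))ₖ = λₖ qₖ sgn(x̄ₖ) |x̄ₖ|^{qₖ - 1}`. -/
theorem stmt_13 {M N : ℕ} (A : Matrix (Fin M) (Fin N) ℝ) (b : Fin M → ℝ)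
    (lam q : Fin N → ℝ)
    (hlam : ∀ k, 0 < lam k) (hq : ∀ k, 1 ≤ q k ∧ q k ≤ 2)
    (x : ℕ → Fin N → ℝ) (eps : ℕ → ℝ) (w : ℕ → Fin N → ℝ)
    (α : ℝ) (hα0 : 0 < α) (hα1 : α < 1) (heps0 : 0 < eps 0)
    (hw : ∀ n k, w n k = ((x n k) ^ 2 + (eps n) ^ 2) ^ ((q k - 2) / 2))
    (hxiter : ∀ n k, x (n + 1) k =
      (1 + lam k * q k * w n k)⁻¹
        * (x n k + Aᵀ.mulVec b k - Aᵀ.mulVec (A.mulVec (x n)) k))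
    (hepsiter : ∀ n, eps (n + 1) =
      min (eps n) (Real.sqrt (l2 (x (n + 1) - x n) + α ^ (n + 1))))
    (hdiff : Tendsto (fun n => l2 (x (n + 1) - x n)) atTop (nhds 0))
    (hepslim : Tendsto eps atTop (nhds 0))
    (r : ℕ → ℕ) (hr : StrictMono r) (xbar : Fin N → ℝ)
    (hconv : Tendsto (fun j => x (r j)) atTop (nhds xbar)) :
    ∀ k : Fin N, xbar k ≠ 0 →
      Aᵀ.mulVec (b - A.mulVec xbar) k
        = lam k * q k * Real.sign (xbar k) * |xbar k| ^ (q k - 1) := by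
  intro k hk
  have hr_top : Tendsto r atTop atTop := hr.tendsto_atTop
  have hxk : Tendsto (fun j => x (r j) k) atTop (𝓝 (xbar k)) := tendsto_pi_nhds.mp hconv k
  have hsuccxk : Tendsto (fun j => x (r j + 1) k) atTop (𝓝 (xbar k)) := by
    simpa using ((tendsto_apply_zero_of_tendsto_l2_zero hdiff k).comp hr_top).add hxk
  have hweight : Tendsto (fun j => w (r j) k) atTop
      (𝓝 ((xbar k ^ 2) ^ ((q k - 2) / 2))) := by
    have hbase : Tendsto (fun j => x (r j) k ^ 2 + eps (r j) ^ 2) atTop (𝓝 (xbar k ^ 2)) := by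
      simpa using (hxk.pow 2).add ((hepslim.comp hr_top).pow 2)
    simpa only [hw] using hbase.rpow_const (Or.inl (pow_ne_zero 2 hk))
  have hgrad : Tendsto (fun j => Aᵀ.mulVec (A.mulVec (x (r j))) k) atTop
      (𝓝 (Aᵀ.mulVec (A.mulVec xbar) k)) := by
    have hcont : Continuous fun y : Fin N → ℝ => Aᵀ.mulVec (A.mulVec y) k :=
      (continuous_apply k).comp
        (continuous_const.matrix_mulVec (continuous_const.matrix_mulVec continuous_id))
    exact (hcont.tendsto xbar).comp hconv
  have hstep (n : ℕ) : (1 + lam k * q k * w n k) * x (n + 1) k =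
      x n k + Aᵀ.mulVec b k - Aᵀ.mulVec (A.mulVec (x n)) k := by
    have hw_nonneg : 0 ≤ w n k := by
      rw [hw]
      positivity
    have hq_nonneg : 0 ≤ q k := zero_le_one.trans (hq k).1
    have hlam_nonneg : 0 ≤ lam k := (hlam k).le
    rw [hxiter, mul_inv_cancel_left₀ (by positivity)]
  have hlimit := tendsto_nhds_unique
    (((hweight.const_mul (lam k * q k)).const_add 1).mul hsuccxk)
    (((hxk.add_const (Aᵀ.mulVec b k)).sub hgrad).congr fun j => (hstep (r j)).symm)
  rw [Matrix.mulVec_sub, Pi.sub_apply, mul_assoc _ (Real.sign _),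
    ← sq_rpow_half_sub_two_mul_self hk]
  linear_combination -hlimit
end
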